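/- Let T be a bounded self-adjoint operator on H ⊗ H with ‖T‖ ≤ 1 satisfying the Yang–Baxter equation T₁T₂T₁ = T₂T₁T₂ on H ⊗ H ⊗ H (where T₁ = T ⊗ 1, T₂ = 1 ⊗ T). Define inductively P_{T,1} = 1 and P_{T,n+1} = (1 ⊗ P_{T,n}) R_{T,n+1}, where R_{T,n} = 1 + T₁ + T₁T₂ + … + T₁⋯T_{n-1} on H^{⊗n}. Then P_{T,n} ≥ 0 for every n. -/

import Mathlib

/-!
STATEMENT 2 (Bożejko–Speicher positivity): Let `T` be a bounded self-adjoint contraction on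
`H ⊗ H` satisfying the Yang–Baxter equation. We work with the tensor powers `E n = H^{⊗n}`,
the leg operators `T n k = 1^{⊗(k-1)} ⊗ T ⊗ 1^{⊗(n-k-1)}` and the ampliation `amp n = 1 ⊗ ·`
(a unital *-homomorphism with `amp n (T n k) = T (n+1) (k+1)`).  With
`R_{T,n} = 1 + T₁ + T₁T₂ + ⋯ + T₁⋯T_{n-1}` and `P_{T,1} = 1`,
`P_{T,n+1} = (1 ⊗ P_{T,n}) R_{T,n+1}`, every `P_{T,n}` is positive.
-/

noncomputable section

variable {E : ℕ → Type*} [∀ n, NormedAddCommGroup (E n)] [∀ n, InnerProductSpace ℂ (E n)]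
  [∀ n, CompleteSpace (E n)]

/-- `chainT T n k = T₁ T₂ ⋯ T_k` acting on the `n`-th tensor power. -/
def chainT (T : ∀ n, ℕ → (E n →L[ℂ] E n)) (n : ℕ) : ℕ → (E n →L[ℂ] E n)
  | 0 => 1
  | k + 1 => chainT T n k * T n (k + 1)

/-- `Rop T n = 1 + T₁ + T₁T₂ + ⋯ + T₁⋯T_{n-1}` on the `n`-th tensor power. -/
def Rop (T : ∀ n, ℕ → (E n →L[ℂ] E n)) (n : ℕ) : E n →L[ℂ] E n :=
  ∑ k ∈ Finset.range n, chainT T n k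

/-- The operators `P_{T,n}`: `P_{T,1} = 1` and `P_{T,n+1} = (1 ⊗ P_{T,n}) R_{T,n+1}`,
where `1 ⊗ ·` is the ampliation `amp`. -/
def Pop (T : ∀ n, ℕ → (E n →L[ℂ] E n))
    (amp : ∀ n, (E n →L[ℂ] E n) →⋆ₐ[ℂ] (E (n + 1) →L[ℂ] E (n + 1))) :
    ∀ n, E n →L[ℂ] E n
  | 0 => 1
  | n + 1 => amp n (Pop T amp n) * Rop T (n + 1)

/-- `chA t i k = t_i t_{i+1} ⋯ t_{i+k-1}`. -/
def chA {A : Type*} [Ring A] (t : ℕ → A) (i : ℕ) : ℕ → A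
  | 0 => 1
  | k + 1 => chA t i k * t (i + k)

/-- `RA t i m = 1 + t_i + ⋯` with `m` terms. -/
def RA {A : Type*} [Ring A] (t : ℕ → A) (i m : ℕ) : A :=
  ∑ k ∈ Finset.range m, chA t i k

/-- Abstract version of `Pop`. -/
def PA {A : Type*} [Ring A] (t : ℕ → A) : ℕ → ℕ → A
  | _, 0 => 1
  | i, m + 1 => PA t (i + 1) m * RA t i (m + 1)

section alg

variable {A : Type*} [Ring A] (t : ℕ → A)

theorem chA_succ_left (i k : ℕ) : t i * chA t (i + 1) k = chA t i (k + 1) := by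
  induction k with
  | zero => simp [chA]
  | succ k ih =>
    rw [chA, ← mul_assoc, ih, chA, chA, chA]
    congr 2
    omega

theorem RA_one (i : ℕ) : RA t i 1 = 1 := by simp [RA, chA]

theorem RA_succ_left (i m : ℕ) : RA t i (m + 1) = 1 + t i * RA t (i + 1) m := by
  rw [RA, Finset.sum_range_succ', RA, Finset.mul_sum, add_comm]
  simp only [chA_succ_left]
  simp [chA]

theorem commute_chA (hcomm : ∀ j k, j + 2 ≤ k → Commute (t j) (t k)) (l i k : ℕ)
    (h : l + 2 ≤ i) : Commute (t l) (chA t i k) := by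
  induction k with
  | zero => exact Commute.one_right _
  | succ k ih => exact ih.mul_right (hcomm _ _ (by omega))

theorem commute_chA' (hcomm : ∀ j k, j + 2 ≤ k → Commute (t j) (t k)) (l i k : ℕ)
    (h : i + k + 1 ≤ l) : Commute (t l) (chA t i k) := by
  induction k with
  | zero => exact Commute.one_right _
  | succ k ih => exact (ih (by omega)).mul_right (hcomm _ _ (by omega)).symm

theorem commute_RA (hcomm : ∀ j k, j + 2 ≤ k → Commute (t j) (t k)) (l i m : ℕ)
    (h : l + 2 ≤ i) : Commute (t l) (RA t i m) :=
  Commute.sum_right _ _ _ fun k _ => commute_chA t hcomm l i k h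

theorem commute_PA (hcomm : ∀ j k, j + 2 ≤ k → Commute (t j) (t k)) (l i m : ℕ)
    (h : l + 2 ≤ i) : Commute (t l) (PA t i m) := by
  induction m generalizing i with
  | zero => exact Commute.one_right _
  | succ m ih => exact (ih (i + 1) (by omega)).mul_right (commute_RA t hcomm l i _ h)

theorem chA_mul_t (hcomm : ∀ j k, j + 2 ≤ k → Commute (t j) (t k))
    (hbraid : ∀ k, t k * t (k + 1) * t k = t (k + 1) * t k * t (k + 1))
    (i k j : ℕ) (hij : i ≤ j) (hj : j + 1 < i + k) :
    chA t i k * t j = t (j + 1) * chA t i k := by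
  induction k with
  | zero => omega
  | succ k ih =>
    by_cases h : j + 1 < i + k
    · rw [chA, mul_assoc, ← (hcomm j (i + k) (by omega)).eq, ← mul_assoc, ih h, mul_assoc]
    · obtain ⟨r, rfl⟩ : ∃ r, k = r + 1 := ⟨k - 1, by omega⟩
      obtain rfl : j = i + r := by omega
      have hc := (commute_chA' t hcomm (i + r + 1) i r (by omega)).eq
      have hb := hbraid (i + r)
      rw [chA, chA, ← add_assoc]
      calc chA t i r * t (i + r) * t (i + r + 1) * t (i + r)
          = chA t i r * (t (i + r) * t (i + r + 1) * t (i + r)) := by noncomm_ring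
        _ = chA t i r * t (i + r + 1) * t (i + r) * t (i + r + 1) := by
          rw [hb]; noncomm_ring
        _ = _ := by rw [← hc]; noncomm_ring

theorem chA_mul_chA (hcomm : ∀ j k, j + 2 ≤ k → Commute (t j) (t k))
    (hbraid : ∀ k, t k * t (k + 1) * t k = t (k + 1) * t k * t (k + 1))
    (i k r : ℕ) (h : r < k) :
    chA t i k * chA t i r = chA t (i + 1) r * chA t i k := by
  induction r with
  | zero => simp [chA]
  | succ r ih =>
    rw [chA, ← mul_assoc, ih (by omega), mul_assoc,
      chA_mul_t t hcomm hbraid i k (i + r) (by omega) (by omega), ← mul_assoc, chA]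
    congr 3
    omega

theorem RA_key (hcomm : ∀ j k, j + 2 ≤ k → Commute (t j) (t k))
    (hbraid : ∀ k, t k * t (k + 1) * t k = t (k + 1) * t k * t (k + 1)) (i m : ℕ) :
    RA t i (m + 2) * (1 - chA t i (m + 1)) = (1 - t i * chA t i (m + 1)) * RA t i (m + 1) := by
  have h1 : RA t i (m + 2) = RA t i (m + 1) + chA t i (m + 1) := by
    rw [RA, Finset.sum_range_succ, RA]
  have h2 : RA t (i + 1) (m + 1) * chA t i (m + 1) = chA t i (m + 1) * RA t i (m + 1) := by
    rw [RA, RA, Finset.sum_mul, Finset.mul_sum]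
    refine Finset.sum_congr rfl fun r hr => ?_
    rw [chA_mul_chA t hcomm hbraid i (m + 1) r (Finset.mem_range.1 hr)]
  have h3 : RA t i (m + 2) * chA t i (m + 1)
      = chA t i (m + 1) + t i * chA t i (m + 1) * RA t i (m + 1) := by
    rw [RA_succ_left t i (m + 1), add_mul, one_mul, mul_assoc, h2, mul_assoc]
  rw [mul_sub, mul_one, h3, h1, sub_mul, one_mul]
  abel

theorem PA_star [StarRing A] (hs : ∀ j, star (t j) = t j)
    (hcomm : ∀ j k, j + 2 ≤ k → Commute (t j) (t k)) (m : ℕ) :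
    (∀ i, star (PA t i m) = PA t i m) ∧ (∀ i, star (PA t i (m + 1)) = PA t i (m + 1)) := by
  induction m with
  | zero => simp [PA, RA_one]
  | succ m ih =>
    refine ⟨ih.2, fun i => ?_⟩
    have hP2 : PA t (i + 1) (m + 1) = PA t (i + 2) m * RA t (i + 1) (m + 1) := by rw [PA]
    have hP2' : PA t (i + 1) (m + 1) = star (RA t (i + 1) (m + 1)) * PA t (i + 2) m := by
      rw [← ih.2 (i + 1), hP2, star_mul, ih.1]
    have hc := (commute_PA t hcomm i (i + 2) m le_rfl).eq
    have hP : PA t i (m + 2) = PA t (i + 1) (m + 1) * RA t i (m + 2) := by rw [PA]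
    rw [hP, star_mul, ih.2, RA_succ_left t i (m + 1), star_add, star_one, star_mul, hs,
      add_mul, mul_add, one_mul, mul_one]
    congr 1
    conv_lhs => rw [hP2]
    conv_rhs => rw [hP2']
    simp only [mul_assoc]
    rw [← mul_assoc (PA t (i + 2) m) (t i), ← hc, ← hP2, mul_assoc, ← hP2, hP2']

theorem PA_map {B : Type*} [Ring B] (f : A →+* B) (t' : ℕ → B) (c i m : ℕ)
    (h : ∀ j, i ≤ j → j + 1 < i + m → f (t j) = t' (j + c)) :
    f (PA t i m) = PA t' (i + c) m := by
  induction m generalizing i with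
  | zero => simp [PA]
  | succ m ih =>
    have hch : ∀ k, k < m + 1 → f (chA t i k) = chA t' (i + c) k := by
      intro k
      induction k with
      | zero => simp [chA]
      | succ k ihk =>
        intro hk
        rw [chA, map_mul, ihk (by omega), h _ (by omega) (by omega), chA]
        congr 2
        omega
    rw [PA, PA, map_mul, ih (i + 1) (fun j h1 h2 => h j (by omega) (by omega)), RA, RA, map_sum,
      Finset.sum_congr rfl (fun k hk => hch k (Finset.mem_range.1 hk))]
    congr 2
    omega

end alg

section cstar

variable {A : Type*} [CStarAlgebra A]

theorem norm_chA (t : ℕ → A) (q : ℝ) (hq : q < 1) (ht : ∀ j, ‖t j‖ ≤ q) (i k : ℕ) :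
    ‖chA t i (k + 1)‖ < 1 := by
  induction k with
  | zero => simpa [chA] using (ht i).trans_lt hq
  | succ k ih =>
    rw [chA]
    refine (norm_mul_le _ _).trans_lt ?_
    have := ht (i + (k + 1))
    nlinarith [norm_nonneg (chA t i (k + 1)), norm_nonneg (t (i + (k + 1)))]

theorem isUnit_PA (t : ℕ → A) (q : ℝ) (hq : q < 1) (ht : ∀ j, ‖t j‖ ≤ q)
    (hcomm : ∀ j k, j + 2 ≤ k → Commute (t j) (t k))
    (hbraid : ∀ k, t k * t (k + 1) * t k = t (k + 1) * t k * t (k + 1)) (i m : ℕ) :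
    IsUnit (PA t i m) := by
  have hR : ∀ i m, IsUnit (RA t i (m + 1)) := by
    intro i m
    induction m with
    | zero => simp [RA_one]
    | succ m ih =>
      have hc := norm_chA t q hq ht i m
      have h1 : IsUnit (1 - chA t i (m + 1)) := isUnit_one_sub_of_norm_lt_one hc
      have h2 : IsUnit (1 - t i * chA t i (m + 1)) := by
        apply isUnit_one_sub_of_norm_lt_one
        refine (norm_mul_le _ _).trans_lt ?_
        have := ht i
        nlinarith [norm_nonneg (chA t i (m + 1)), norm_nonneg (t i)]
      have h3 := h2.mul ih
      rw [← RA_key t hcomm hbraid] at h3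
      obtain ⟨u, hu⟩ := h1
      rw [← hu] at h3
      exact (Units.isUnit_mul_units _ u).1 h3
  induction m generalizing i with
  | zero => simp [PA]
  | succ m ih => exact (ih (i + 1)).mul (hR i m)

theorem PA_zero (i m : ℕ) : PA (fun _ => (0 : A)) i m = 1 := by
  induction m generalizing i with
  | zero => simp [PA]
  | succ m ih =>
    rw [PA, ih, RA_succ_left]
    simp

theorem continuous_PA (t : ℝ → ℕ → A) (ht : ∀ j, Continuous fun q => t q j) (i m : ℕ) :
    Continuous fun q => PA (t q) i m := by
  have hch : ∀ i k, Continuous fun q => chA (t q) i k := by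
    intro i k
    induction k with
    | zero => exact continuous_const
    | succ k ih => exact ih.mul (ht _)
  induction m generalizing i with
  | zero => exact continuous_const
  | succ m ih => exact (ih (i + 1)).mul (continuous_finset_sum _ fun k _ => hch i k)

variable [PartialOrder A] [StarOrderedRing A]

theorem nonneg_near (a : A) (ha : 0 ≤ a) (hu : IsUnit a) :
    ∃ ε > 0, ∀ b : A, IsSelfAdjoint b → ‖b - a‖ < ε → 0 ≤ b := by
  rcases subsingleton_or_nontrivial A with h | h
  · exact ⟨1, one_pos, fun b _ _ => (Subsingleton.elim 0 b).le⟩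
  obtain ⟨r, hr, hra⟩ := (CFC.exists_pos_algebraMap_le_iff (a := a) (IsSelfAdjoint.of_nonneg ha)).2
    (fun x hx => lt_of_le_of_ne (spectrum_nonneg_of_nonneg ha hx) (by
      rintro rfl
      exact spectrum.zero_notMem ℝ hu hx))
  refine ⟨r, hr, fun b hb hba => ?_⟩
  have h1 := (hb.sub (IsSelfAdjoint.of_nonneg ha)).neg_algebraMap_norm_le_self
  have h2 : algebraMap ℝ A ‖b - a‖ ≤ algebraMap ℝ A r := algebraMap_mono A hba.le
  have h3 : -a ≤ b - a := (neg_le_neg (h2.trans hra)).trans h1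
  simpa using add_le_add_left h3 a

theorem PA_nonneg (t : ℕ → A) (hs : ∀ j, star (t j) = t j) (ht : ∀ j, ‖t j‖ ≤ 1)
    (hcomm : ∀ j k, j + 2 ≤ k → Commute (t j) (t k))
    (hbraid : ∀ k, t k * t (k + 1) * t k = t (k + 1) * t k * t (k + 1)) (i m : ℕ) :
    0 ≤ PA t i m := by
  set u : ℝ → ℕ → A := fun q j => (q : ℂ) • t j with hu
  have hcu : ∀ q j k, j + 2 ≤ k → Commute (u q j) (u q k) := fun q j k h =>
    ((hcomm j k h).smul_left _).smul_right _
  have hbu : ∀ q k, u q k * u q (k + 1) * u q k = u q (k + 1) * u q k * u q (k + 1) := by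
    intro q k
    simp only [hu, smul_mul_assoc, mul_smul_comm, hbraid k]
  have hsu : ∀ q j, star (u q j) = u q j := by
    intro q j
    simp [hu, hs]
  have hcont : Continuous fun q => PA (u q) i m :=
    continuous_PA u (fun j => (Complex.continuous_ofReal.smul continuous_const)) i m
  have hcl : IsClosed {q : ℝ | 0 ≤ PA (u q) i m} :=
    (CStarAlgebra.isClosed_nonneg (A := A)).preimage hcont
  have key : Set.Icc (0 : ℝ) 1 ⊆ {q : ℝ | 0 ≤ PA (u q) i m} := by
    refine IsClosed.Icc_subset_of_forall_mem_nhdsWithin (hcl.inter isClosed_Icc) ?_ ?_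
    · have : u 0 = fun _ => 0 := by funext j; simp [hu]
      simp [this, PA_zero]
    · rintro q ⟨hq, hq0, hq1⟩
      have hun : IsUnit (PA (u q) i m) := by
        refine isUnit_PA (u q) q hq1 (fun j => ?_) (hcu q) (hbu q) i m
        simp only [hu, norm_smul, Complex.norm_real, Real.norm_eq_abs, abs_of_nonneg hq0]
        nlinarith [ht j]
      obtain ⟨ε, hε, h⟩ := nonneg_near _ hq hun
      apply mem_nhdsWithin_of_mem_nhds
      filter_upwards [Metric.continuousAt_iff'.1 hcont.continuousAt ε hε] with p hp
      rw [dist_eq_norm] at hp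
      exact h _ ((PA_star (u p) (hsu p) (hcu p) m).1 i) hp
  have h1 := key (Set.right_mem_Icc.2 zero_le_one)
  have : u 1 = t := by funext j; simp [hu]
  simpa [this] using h1

end cstar

theorem chainT_eq (T : ∀ n, ℕ → (E n →L[ℂ] E n)) (n k : ℕ) :
    chainT T n k = chA (T n) 1 k := by
  induction k with
  | zero => rfl
  | succ k ih => rw [chainT, chA, ih, add_comm]

theorem Pop_eq (T : ∀ n, ℕ → (E n →L[ℂ] E n))
    (amp : ∀ n, (E n →L[ℂ] E n) →⋆ₐ[ℂ] (E (n + 1) →L[ℂ] E (n + 1)))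
    (hamp : ∀ n k, 1 ≤ k → k ≤ n - 1 → amp n (T n k) = T (n + 1) (k + 1)) (n : ℕ) :
    Pop T amp n = PA (T n) 1 n := by
  induction n with
  | zero => rfl
  | succ n ih =>
    rw [Pop, PA, ih, Rop, RA]
    congr 1
    · exact PA_map (T n) ((amp n : (E n →L[ℂ] E n) →+* (E (n + 1) →L[ℂ] E (n + 1))))
        (T (n + 1)) 1 1 n (fun j h1 h2 => hamp n j h1 (by omega))
    · exact Finset.sum_congr rfl fun k _ => chainT_eq T (n + 1) k

theorem stmt2
    (T : ∀ n, ℕ → (E n →L[ℂ] E n))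
    (amp : ∀ n, (E n →L[ℂ] E n) →⋆ₐ[ℂ] (E (n + 1) →L[ℂ] E (n + 1)))
    -- `T n k` is the `k`-th leg embedding of the twist; `amp` is the left ampliation `1 ⊗ ·`
    (hamp : ∀ n k, 1 ≤ k → k ≤ n - 1 → amp n (T n k) = T (n + 1) (k + 1))
    -- `T` is self-adjoint with `‖T‖ ≤ 1`
    (hsa : ∀ n k, 1 ≤ k → k ≤ n - 1 → IsSelfAdjoint (T n k))
    (hcontr : ∀ n k, 1 ≤ k → k ≤ n - 1 → ‖T n k‖ ≤ 1)
    -- Yang–Baxter (braid) relations and distant commutation of the legs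
    (hbraid : ∀ n k, 1 ≤ k → k + 1 ≤ n - 1 →
      T n k * T n (k + 1) * T n k = T n (k + 1) * T n k * T n (k + 1))
    (hcomm : ∀ n j k, 1 ≤ j → j + 2 ≤ k → k ≤ n - 1 → Commute (T n j) (T n k)) :
    ∀ n, (Pop T amp n).IsPositive := by
  intro n
  rw [Pop_eq T amp hamp n, ← ContinuousLinearMap.nonneg_iff_isPositive]
  set t : ℕ → (E n →L[ℂ] E n) := fun k => if 1 ≤ k ∧ k ≤ n - 1 then T n k else 0 with ht
  have hPt : PA (T n) 1 n = PA t 1 n := by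
    refine PA_map (T n) (RingHom.id _) t 0 1 n (fun j h1 h2 => ?_)
    simp only [ht, RingHom.id_apply, add_zero]
    rw [if_pos ⟨h1, by omega⟩]
  rw [hPt]
  refine PA_nonneg t (fun j => ?_) (fun j => ?_) (fun j k h => ?_) (fun k => ?_) 1 n
  · simp only [ht]
    split_ifs with h
    · exact hsa n j h.1 h.2
    · simp
  · simp only [ht]
    split_ifs with h
    · exact hcontr n j h.1 h.2
    · simp
  · simp only [ht]
    split_ifs with h1 h2 h2
    · exact hcomm n j k h1.1 h h2.2
    · exact Commute.zero_right _
    · exact Commute.zero_left _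
    · exact Commute.zero_left _
  · simp only [ht]
    split_ifs with h1 h2 h2
    · exact hbraid n k h1.1 h2.2
    · simp
    · simp
    · simp

end
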